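/- arXiv:1608.01412 — 2 statements merged into one kernel-verified Lean document; each statement's English description precedes it below -/
import Mathlib

section
/- Let m be an even positive integer, n a positive integer, and w = e^{2πi/(2m)}. For a tuple ε = (ε₁,…,ε_{m−1}) with each εⱼ = ±1, let sign(ε) = 1 if the number of −1's among ε₁,…,ε_{m−1} is even and sign(ε) = −1 otherwise. Then ζ({2m}^n) = ((−1)^{n+1+m/2} π^{2mn} / (2^{m−2} (2mn+m)!)) · Im( Σ_{ε: sign(ε)=1} (w^{m−1} + ε₁ w^{m−2} + ⋯ + ε_{m−1})^{2mn+m} ), where Im denotes the imaginary part. -/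
open Real Finset

/-- Multiple zeta value with real exponents `a i`, summed over
`1 ≤ k₁ < k₂ < ⋯ < k_r`. -/
noncomputable def mzv {r : ℕ} (a : Fin r → ℝ) : ℝ :=
  ∑' f : {f : Fin r → ℕ // (∀ i, 1 ≤ f i) ∧ StrictMono f},
    ∏ i, ((f.1 i : ℝ)) ^ (-(a i))

/-- Multiple zeta star value with real exponents `a i`, summed over
`1 ≤ k₁ ≤ k₂ ≤ ⋯ ≤ k_r`. -/
noncomputable def mzsv {r : ℕ} (a : Fin r → ℝ) : ℝ :=
  ∑' f : {f : Fin r → ℕ // (∀ i, 1 ≤ f i) ∧ Monotone f},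
    ∏ i, ((f.1 i : ℝ)) ^ (-(a i))

/-- Coefficients of an everywhere convergent power series are determined by its sum. -/
lemma coeff_eq_of_hasSum_pow {a b : ℕ → ℂ} {f : ℂ → ℂ}
    (ha : ∀ z, HasSum (fun n => a n * z ^ n) (f z))
    (hb : ∀ z, HasSum (fun n => b n * z ^ n) (f z)) : a = b := by
  have key (c : ℕ → ℂ) (hc : ∀ z, HasSum (fun n => c n * z ^ n) (f z)) :
      HasFPowerSeriesAt f (FormalMultilinearSeries.ofScalars ℂ c) 0 := by
    rw [hasFPowerSeriesAt_iff]
    refine Filter.Eventually.of_forall fun z => ?_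
    simpa [FormalMultilinearSeries.coeff_ofScalars, mul_comm] using hc z
  funext n
  simpa [FormalMultilinearSeries.coeff_ofScalars] using
    congrArg (fun p => FormalMultilinearSeries.coeff p n)
      ((key a ha).eq_formalMultilinearSeries (key b hb))

/-- Finite sets of `n` natural numbers correspond to strictly increasing sequences of `n` positive
integers. -/
noncomputable def finsetCardEquivStrictMono (n : ℕ) :
    (Finset.card ⁻¹' {n} : Set (Finset ℕ)) ≃
      {f : Fin n → ℕ // (∀ i, 1 ≤ f i) ∧ StrictMono f} :=
  Equiv.ofBijective
    (fun s => ⟨fun i => s.1.orderEmbOfFin s.2 i + 1, fun i => Nat.le_add_left _ _,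
      fun _ _ h => Nat.add_lt_add_right ((s.1.orderEmbOfFin s.2).strictMono h) 1⟩) <| by
    constructor
    · rintro ⟨s, hs⟩ ⟨t, ht⟩ h
      have h' : (s.orderEmbOfFin hs : Fin n → ℕ) = t.orderEmbOfFin ht := by
        funext i
        simpa using congrFun (congrArg Subtype.val h) i
      apply Subtype.ext
      apply Finset.coe_injective
      rw [← Finset.range_orderEmbOfFin s hs, ← Finset.range_orderEmbOfFin t ht, h']
    · rintro ⟨f, h1, hf⟩
      have hmono : StrictMono fun i => f i - 1 := fun i j hij => by
        have := hf hij
        have := h1 i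
        simp only
        omega
      have hcard : (Finset.univ.image fun i => f i - 1).card = n := by
        rw [Finset.card_image_of_injective _ hmono.injective, Finset.card_univ, Fintype.card_fin]
      refine ⟨⟨Finset.univ.image fun i => f i - 1, hcard⟩, Subtype.ext ?_⟩
      have hu := Finset.orderEmbOfFin_unique hcard
        (fun i => Finset.mem_image_of_mem (fun i => f i - 1) (Finset.mem_univ i)) hmono
      funext i
      have hi := congrFun hu i
      have := h1 i
      simp only at hi ⊢
      omega

lemma prod_finsetCardEquivStrictMono (n : ℕ) (s : (Finset.card ⁻¹' {n} : Set (Finset ℕ)))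
    (g : ℕ → ℂ) : ∏ i, g ((finsetCardEquivStrictMono n s).1 i) = ∏ k ∈ s.1, g (k + 1) := by
  conv_rhs => rw [← Finset.image_orderEmbOfFin_univ s.1 s.2]
  rw [Finset.prod_image fun _ _ _ _ h => (s.1.orderEmbOfFin s.2).injective h]
  rfl

/-- The generating function of the multiple zeta values `ζ({p}^n)` as an infinite product. -/
lemma exists_hasProd_hasSum_mzv_rep {p : ℕ} (hp : 2 ≤ p) (z : ℂ) :
    ∃ a : ℂ, HasProd (fun k : ℕ => 1 - z ^ p / ((k : ℂ) + 1) ^ p) a ∧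
      HasSum (fun n : ℕ => (-1) ^ n * (mzv (fun _ : Fin n => (p : ℝ)) : ℂ) * z ^ (p * n)) a := by
  set f : ℕ → ℂ := fun k => -(z ^ p / ((k : ℂ) + 1) ^ p) with hf
  have hsum : Summable fun k => ‖f k‖ := by
    have h := ((summable_nat_add_iff 1).mpr (Real.summable_nat_pow_inv.mpr hp)).mul_left (‖z‖ ^ p)
    refine h.congr fun k => ?_
    have hk : ‖(k : ℂ) + 1‖ = (k : ℝ) + 1 := by
      exact_mod_cast Complex.norm_natCast (k + 1)
    simp [hf, hk, div_eq_mul_inv]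
  have hs := (summable_finsetProd_of_summable_norm hsum).hasSum
  refine ⟨_, by simpa [hf, sub_eq_add_neg] using hasProd_one_add_of_hasSum_prod hs, ?_⟩
  convert! hs.tsum_fiberwise Finset.card using 1
  funext n
  have hterm (s : (Finset.card ⁻¹' {n} : Set (Finset ℕ))) : ∏ k ∈ s.1, f k =
      (-1) ^ n * z ^ (p * n) *
        ∏ i, ((((finsetCardEquivStrictMono n s).1 i : ℝ) ^ (-(p : ℝ)) : ℝ) : ℂ) := by
    rw [prod_finsetCardEquivStrictMono n s fun k => (((k : ℝ) ^ (-(p : ℝ)) : ℝ) : ℂ)]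
    have hc : s.1.card = n := s.2
    have hfk (k : ℕ) : f k = -(z ^ p) * ((((k + 1 : ℕ) : ℝ) ^ (-(p : ℝ)) : ℝ) : ℂ) := by
      rw [Real.rpow_neg (by positivity), Real.rpow_natCast]
      simp [hf, div_eq_mul_inv]
    rw [Finset.prod_congr rfl fun k _ => hfk k, Finset.prod_mul_distrib, Finset.prod_const, hc,
      neg_pow, pow_mul]
  rw [tsum_congr hterm, tsum_mul_left, mzv, Complex.ofReal_tsum]
  rw [(finsetCardEquivStrictMono n).tsum_eq
    fun g => ∏ i, (((g.1 i : ℝ) ^ (-(p : ℝ)) : ℝ) : ℂ)]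
  simp only [Complex.ofReal_prod]
  ring

lemma IsPrimitiveRoot.prod_range_one_sub {R : Type*} [CommRing R] [IsDomain R] {ζ : R} {m : ℕ}
    (h : IsPrimitiveRoot ζ m) (hm : 0 < m) (y : R) :
    ∏ j ∈ Finset.range m, (1 - ζ ^ j * y) = 1 - y ^ m := by
  have := congrArg (Polynomial.eval 1) (X_pow_sub_C_eq_prod h hm (rfl : y ^ m = y ^ m))
  simpa [Polynomial.eval_prod] using this.symm

/-- Product of the sine functions `sin (π w ^ j z)` for `w` of order `2 m`, as a power series whose
coefficients are the values `ζ({2m}^n)`. -/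
lemma hasSum_prod_sin {m : ℕ} (hm : 0 < m) {w : ℂ} (hw : IsPrimitiveRoot (w ^ 2) m) (z : ℂ) :
    HasSum (fun n : ℕ => (∏ j ∈ Finset.range m, (π * w ^ j)) *
        ((-1) ^ n * (mzv (fun _ : Fin n => ((2 * m : ℕ) : ℝ)) : ℂ)) * z ^ (2 * m * n + m))
      (∏ j ∈ Finset.range m, Complex.sin (π * (w ^ j * z))) := by
  obtain ⟨a, hprod, hsum⟩ := exists_hasProd_hasSum_mzv_rep (p := 2 * m) (by omega) z
  have hlim := tendsto_finsetProd (Finset.range m)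
    fun j _ => Complex.tendsto_euler_sin_prod (w ^ j * z)
  have hlim' := hprod.tendsto_prod_nat.const_mul (∏ j ∈ Finset.range m, (π * (w ^ j * z)))
  have heq : ∏ j ∈ Finset.range m, Complex.sin (π * (w ^ j * z)) =
      (∏ j ∈ Finset.range m, (π * (w ^ j * z))) * a := by
    refine tendsto_nhds_unique hlim (hlim'.congr fun N => ?_)
    symm
    rw [Finset.prod_mul_distrib, Finset.prod_comm]
    congr 1
    refine Finset.prod_congr rfl fun k _ => ?_
    rw [pow_mul z, pow_mul ((k : ℂ) + 1), ← div_pow, ← hw.prod_range_one_sub hm]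
    refine Finset.prod_congr rfl fun j _ => ?_
    ring
  rw [heq]
  convert! hsum.mul_left (∏ j ∈ Finset.range m, (π * (w ^ j * z))) using 1
  funext n
  simp only [← mul_assoc, Finset.prod_mul_distrib, Finset.prod_const, Finset.card_range]
  ring

/-- The sign `1` or `-1` encoded by a Boolean. -/
noncomputable def boolSign (b : Bool) : ℂ := if b then 1 else -1

@[simp] lemma boolSign_not (b : Bool) : boolSign (!b) = -boolSign b := by
  cases b <;> simp [boolSign]

lemma prod_sub_exp_neg {ι : Type*} [Fintype ι] [DecidableEq ι] (x : ι → ℂ) :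
    ∏ i, (Complex.exp (x i) - Complex.exp (-x i)) =
      ∑ ε : ι → Bool, (∏ i, boolSign (ε i)) * Complex.exp (∑ i, boolSign (ε i) * x i) := by
  have h (i : ι) : Complex.exp (x i) - Complex.exp (-x i) =
      ∑ b : Bool, boolSign b * Complex.exp (boolSign b * x i) := by
    simp [boolSign, sub_eq_add_neg]
  simp only [h, Fintype.prod_sum, Finset.prod_mul_distrib, Complex.exp_sum]

/-- The product of sines, expanded into exponentials, as a power series. -/
lemma hasSum_prod_sin_exp {ι : Type*} [Fintype ι] [DecidableEq ι] (x : ι → ℂ) (z : ℂ) :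
    HasSum (fun l : ℕ => ((2 * Complex.I) ^ Fintype.card ι)⁻¹ *
        (∑ ε : ι → Bool, (∏ i, boolSign (ε i)) *
          (π * Complex.I * ∑ i, boolSign (ε i) * x i) ^ l / (l.factorial : ℂ)) * z ^ l)
      (∏ i, Complex.sin (π * (x i * z))) := by
  have hsin : ∏ i, Complex.sin (π * (x i * z)) = ((2 * Complex.I) ^ Fintype.card ι)⁻¹ *
      ∑ ε : ι → Bool, (∏ i, boolSign (ε i)) *
        Complex.exp (π * Complex.I * (∑ i, boolSign (ε i) * x i) * z) := by
    have h (i : ι) : Complex.sin (π * (x i * z)) = (2 * Complex.I)⁻¹ *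
        (Complex.exp (π * (x i * z) * Complex.I) - Complex.exp (-(π * (x i * z) * Complex.I))) := by
      rw [Complex.sin, neg_mul, mul_inv, Complex.inv_I]
      ring
    simp only [h, Finset.prod_mul_distrib, prod_sub_exp_neg, Finset.prod_const, Finset.card_univ,
      inv_pow]
    congr 1
    refine Finset.sum_congr rfl fun ε _ => ?_
    rw [Finset.mul_sum, Finset.sum_mul]
    congr 2
    exact Finset.sum_congr rfl fun i _ => by ring
  rw [hsin]
  simp_rw [mul_assoc _ (Finset.sum _ _) _, Finset.sum_mul]
  refine HasSum.mul_left _ (hasSum_sum fun ε _ => ?_)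
  have := (NormedSpace.expSeries_div_hasSum_exp
    (π * Complex.I * (∑ i, boolSign (ε i) * x i) * z)).mul_left (∏ i, boolSign (ε i))
  rw [← Complex.exp_eq_exp_ℂ] at this
  convert! this using 1
  · funext l
    ring
  · simp only [mul_assoc, Finset.sum_mul]

lemma sum_boolFun_succ {k : ℕ} (F : (Fin (k + 1) → Bool) → ℂ) :
    ∑ ε, F ε = ∑ e : Fin k → Bool, (F (Fin.cons true e) + F (Fin.cons false e)) := by
  rw [← (Fin.consEquiv fun _ : Fin (k + 1) => Bool).sum_comp, Fintype.sum_prod_type,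
    Fintype.sum_bool, Finset.sum_add_distrib]
  rfl

lemma sum_boolFun_succ' {k : ℕ} (F : (Fin (k + 1) → Bool) → ℂ) :
    ∑ ε, F ε = ∑ e : Fin k → Bool, (F (Fin.snoc e true) + F (Fin.snoc e false)) := by
  rw [← (Fin.snocEquiv fun _ : Fin (k + 1) => Bool).sum_comp, Fintype.sum_prod_type,
    Fintype.sum_bool, Finset.sum_add_distrib]
  rfl

lemma sum_boolFun_not {ι : Type*} [Fintype ι] [DecidableEq ι] (F : (ι → Bool) → ℂ) :
    ∑ ε : ι → Bool, F (fun i => !ε i) = ∑ ε, F ε :=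
  (Equiv.piCongrRight fun _ : ι => Equiv.boolNot).sum_comp F

lemma prod_boolSign {ι : Type*} [Fintype ι] (ε : ι → Bool) :
    ∏ i, boolSign (ε i) = (-1) ^ (Finset.univ.filter fun i => ε i = false).card := by
  simp only [boolSign]
  rw [Finset.prod_ite]
  simp

/-- The sum of `(± w ^ k ± ⋯ ± 1) ^ N` over all choices of signs vanishes if `w ^ (k + 1) = -1` and
`w ^ N = -1`. -/
lemma sum_signed_pow_eq_zero {k N : ℕ} {w : ℂ} (hw : w ^ (k + 1) = -1) (hN : w ^ N = -1) :
    ∑ ε : Fin (k + 1) → Bool, (∑ i, boolSign (ε i) * w ^ (k - (i : ℕ))) ^ N = 0 := by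
  have h : w ^ N * ∑ ε : Fin (k + 1) → Bool, (∑ i, boolSign (ε i) * w ^ (k - (i : ℕ))) ^ N =
      ∑ ε : Fin (k + 1) → Bool, (∑ i, boolSign (ε i) * w ^ (k - (i : ℕ))) ^ N := by
    rw [Finset.mul_sum]
    simp only [← mul_pow]
    conv_rhs => rw [sum_boolFun_succ']
    rw [sum_boolFun_succ]
    refine Finset.sum_congr rfl fun e _ => ?_
    rw [add_comm]
    have hrot (b : Bool) :
        w * ∑ i, boolSign (Fin.cons (α := fun _ => Bool) b e i) * w ^ (k - (i : ℕ)) =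
        ∑ i, boolSign (Fin.snoc (α := fun _ => Bool) e (!b) i) * w ^ (k - (i : ℕ)) := by
      rw [Fin.sum_univ_succ, Fin.sum_univ_castSucc, mul_add, Finset.mul_sum, add_comm]
      congr 1
      · refine Finset.sum_congr rfl fun j _ => ?_
        have : k - (j : ℕ) = k - (j + 1) + 1 := by omega
        simp only [Fin.cons_succ, Fin.val_succ, Fin.snoc_castSucc, Fin.val_castSucc]
        rw [this]
        ring
      · simp only [Fin.cons_zero, Fin.val_zero, Fin.snoc_last, Fin.val_last, boolSign_not,
          Nat.sub_self, Nat.sub_zero]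
        linear_combination boolSign b * hw
    rw [hrot, hrot]
    rfl
  rw [hN] at h
  linear_combination (-1 / 2 : ℂ) * h

/-- The signed sum over all sign vectors in terms of the sum over the sign vectors with leading
sign `1` and an even number of `-1`s. -/
lemma sum_prod_boolSign_mul_pow {k N : ℕ} {w : ℂ} (hk : Odd k) (hN : Even N)
    (hw : w ^ (k + 1) = -1) (hwN : w ^ N = -1) :
    ∑ ε : Fin (k + 1) → Bool,
        (∏ i, boolSign (ε i)) * (∑ i, boolSign (ε i) * w ^ (k - (i : ℕ))) ^ N =
      4 * ∑ ε ∈ Finset.univ.filter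
          (fun ε : Fin k → Bool => Even (Finset.univ.filter (fun j => ε j = false)).card),
        (w ^ k + ∑ j : Fin k, boolSign (ε j) * w ^ (k - 1 - (j : ℕ))) ^ N := by
  set S : (Fin k → Bool) → ℂ :=
    fun e => w ^ k + ∑ j : Fin k, boolSign (e j) * w ^ (k - 1 - (j : ℕ)) with hS
  have htrue (e : Fin k → Bool) :
      ∑ i, boolSign (Fin.cons (α := fun _ => Bool) true e i) * w ^ (k - (i : ℕ)) = S e := by
    simp [Fin.sum_univ_succ, hS, boolSign, Nat.sub_sub, add_comm]
  have hfalse (e : Fin k → Bool) :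
      ∑ i, boolSign (Fin.cons (α := fun _ => Bool) false e i) * w ^ (k - (i : ℕ)) =
        -S fun j => !e j := by
    simp only [Fin.sum_univ_succ, hS, boolSign_not, Nat.sub_sub, add_comm, neg_mul,
      Finset.sum_neg_distrib, Fin.cons_zero, Fin.cons_succ, Fin.val_zero, Fin.val_succ]
    simp [boolSign, add_comm]
  have hplain : ∑ e, S e ^ N = 0 := by
    have h := sum_signed_pow_eq_zero hw hwN
    rw [sum_boolFun_succ] at h
    simp only [htrue, hfalse, hN.neg_pow, Finset.sum_add_distrib] at h
    rw [sum_boolFun_not fun e => S e ^ N] at h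
    linear_combination (1 / 2 : ℂ) * h
  have hsigned : ∑ e : Fin k → Bool, (∏ i, boolSign (!e i)) * S e ^ N =
      -∑ e : Fin k → Bool, (∏ i, boolSign (e i)) * S e ^ N := by
    simp only [boolSign_not, Finset.prod_neg, Finset.card_univ, Fintype.card_fin, hk.neg_one_pow,
      neg_mul, one_mul, Finset.sum_neg_distrib]
  have hfilter : ∑ e ∈ Finset.univ.filter
        (fun e : Fin k → Bool => Even (Finset.univ.filter (fun j => e j = false)).card), S e ^ N =
      (1 / 2 : ℂ) * (∑ e, S e ^ N + ∑ e : Fin k → Bool, (∏ i, boolSign (e i)) * S e ^ N) := by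
    rw [Finset.sum_filter, ← Finset.sum_add_distrib, Finset.mul_sum]
    refine Finset.sum_congr rfl fun e _ => ?_
    rw [prod_boolSign]
    split_ifs with he
    · rw [he.neg_one_pow]
      ring
    · rw [(Nat.not_even_iff_odd.mp he).neg_one_pow]
      ring
  have hnot := sum_boolFun_not fun e : Fin k → Bool => (∏ i, boolSign (!e i)) * S e ^ N
  simp only [Bool.not_not] at hnot
  rw [hfilter, hplain, sum_boolFun_succ]
  simp only [htrue, hfalse, hN.neg_pow, Fin.prod_univ_succ, Fin.cons_zero, Fin.cons_succ,
    Finset.sum_add_distrib, mul_assoc, ← Finset.mul_sum]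
  rw [hnot, hsigned]
  simp only [boolSign]
  norm_num
  ring

/-- For even positive `m` and `w = e^{2πi/(2m)}`,
`ζ({2m}^n) = ((-1)^{n+1+m/2} π^{2mn} / (2^{m-2} (2mn+m)!)) ·
  Im( Σ_{sign(ε)=1} (w^{m-1} + ε₁ w^{m-2} + ⋯ + ε_{m-1})^{2mn+m} )`,
where the sum runs over `ε ∈ {±1}^{m-1}` with an even number of `-1`'s
(encoded by `ε : Fin (m-1) → Bool`, where `true ↦ 1` and `false ↦ -1`). -/
theorem zeta_two_m_rep_even (m n : ℕ) (hm : Even m) (hm0 : 0 < m) (hn : 1 ≤ n)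
    (w : ℂ) (hw : w = Complex.exp (2 * π * Complex.I / (2 * m))) :
    mzv (fun _ : Fin n => ((2 * m : ℕ) : ℝ)) =
      (-1 : ℝ) ^ (n + 1 + m / 2) * π ^ (2 * m * n) /
          (2 ^ (m - 2) * (Nat.factorial (2 * m * n + m))) *
        (∑ ε ∈ Finset.univ.filter
            (fun ε : Fin (m - 1) → Bool =>
              Even (Finset.univ.filter (fun j => ε j = false)).card),
          (w ^ (m - 1) +
            ∑ j : Fin (m - 1), (if ε j then (1 : ℂ) else -1) * w ^ (m - 2 - (j : ℕ)))
            ^ (2 * m * n + m)).im := by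
  obtain ⟨q, hq⟩ := hm
  obtain ⟨k, rfl⟩ : ∃ k, m = k + 1 := ⟨m - 1, by omega⟩
  have hprim : IsPrimitiveRoot w (2 * (k + 1)) := by
    have h := Complex.isPrimitiveRoot_exp (2 * (k + 1)) (by omega)
    rw [hw]
    exact_mod_cast h
  have hprim2 : IsPrimitiveRoot (w ^ 2) (k + 1) := hprim.pow (by omega) rfl
  have hwq : w ^ q = Complex.I := by
    have hq0 : (q : ℂ) ≠ 0 := by
      have : q ≠ 0 := by omega
      exact_mod_cast this
    have hkq : ((k + 1 : ℕ) : ℂ) = 2 * q := by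
      rw [hq]
      push_cast
      ring
    rw [hw, ← Complex.exp_nat_mul, hkq]
    convert! Complex.exp_pi_div_two_mul_I using 2
    field_simp
  have hwk : w ^ (k + 1) = -1 := by
    rw [hq, pow_add, hwq, Complex.I_mul_I]
  set N := 2 * (k + 1) * n + (k + 1) with hN
  have hN' : N = (k + 1) * (2 * n + 1) := by rw [hN]; ring
  have hwN : w ^ N = -1 := by
    rw [hN', pow_mul, hwk]
    exact Odd.neg_one_pow ⟨n, rfl⟩
  have hNeven : Even N := by
    rw [hN', hq]
    exact (Even.add_self q).mul_right _
  have hcoeff : (∏ j ∈ Finset.range (k + 1), ((π : ℂ) * w ^ j)) *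
        ((-1) ^ n * (mzv (fun _ : Fin n => ((2 * (k + 1) : ℕ) : ℝ)) : ℂ)) =
      ((2 * Complex.I) ^ (k + 1))⁻¹ * (∑ ε : Fin (k + 1) → Bool, (∏ i, boolSign (ε i)) *
          (π * Complex.I * ∑ i, boolSign (ε i) * w ^ (k - (i : ℕ))) ^ N / (N.factorial : ℂ)) := by
    have hinj : Function.Injective fun n : ℕ => 2 * (k + 1) * n + (k + 1) := fun a b hab => by
      simpa using hab
    have hA (z : ℂ) := (hasSum_extend_zero hinj).mpr (hasSum_prod_sin hm0 hprim2 z)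
    have hcoeffs := coeff_eq_of_hasSum_pow
      (a := Function.extend (fun n : ℕ => 2 * (k + 1) * n + (k + 1))
        (fun n : ℕ => (∏ j ∈ Finset.range (k + 1), ((π : ℂ) * w ^ j)) *
          ((-1) ^ n * (mzv (fun _ : Fin n => ((2 * (k + 1) : ℕ) : ℝ)) : ℂ))) 0)
      (f := fun z => ∏ j ∈ Finset.range (k + 1), Complex.sin (π * (w ^ j * z)))
      (fun z => ?_)
      (fun z => by
        have h := hasSum_prod_sin_exp (fun i : Fin (k + 1) => w ^ (k - (i : ℕ))) z
        have hr := Finset.prod_range_reflect (fun j => Complex.sin (π * (w ^ j * z))) (k + 1)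
        rw [Finset.prod_range] at hr
        simp only [Nat.add_sub_cancel] at hr
        rwa [hr] at h)
    · have h := congrFun hcoeffs N
      rw [hN, hinj.extend_apply] at h
      simpa only [Fintype.card_fin] using h
    · convert! hA z using 1
      funext l
      by_cases hl : ∃ n, 2 * (k + 1) * n + (k + 1) = l
      · obtain ⟨n, rfl⟩ := hl
        simp only [hinj.extend_apply]
      · simp only [Function.extend_apply' _ _ _ hl, Pi.zero_apply, zero_mul]
  have hprodw : ∏ j ∈ Finset.range (k + 1), ((π : ℂ) * w ^ j) = π ^ (k + 1) * Complex.I ^ k := by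
    rw [Finset.prod_mul_distrib, Finset.prod_const, Finset.card_range, Finset.prod_pow_eq_pow_sum,
      Finset.sum_range_id, Nat.add_sub_cancel, ← hwq, ← pow_mul, hq, ← two_mul, mul_assoc,
      Nat.mul_div_cancel_left _ two_pos]
  have hsigned := sum_prod_boolSign_mul_pow (k := k) ⟨q - 1, by omega⟩ hNeven hwk hwN
  have hfactor : (∑ ε : Fin (k + 1) → Bool, (∏ i, boolSign (ε i)) *
        (π * Complex.I * ∑ i, boolSign (ε i) * w ^ (k - (i : ℕ))) ^ N / (N.factorial : ℂ)) =
      (π * Complex.I) ^ N / (N.factorial : ℂ) * ∑ ε : Fin (k + 1) → Bool,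
        (∏ i, boolSign (ε i)) * (∑ i, boolSign (ε i) * w ^ (k - (i : ℕ))) ^ N := by
    rw [Finset.mul_sum]
    refine Finset.sum_congr rfl fun ε _ => ?_
    rw [mul_pow _ (∑ i, _)]
    ring
  rw [hprodw, hfactor, hsigned] at hcoeff
  set A : ℂ := ∑ ε ∈ Finset.univ.filter
      (fun ε : Fin k → Bool => Even (Finset.univ.filter (fun j => ε j = false)).card),
    (w ^ k + ∑ j : Fin k, boolSign (ε j) * w ^ (k - 1 - (j : ℕ))) ^ N
  change mzv (fun _ : Fin n => ((2 * (k + 1) : ℕ) : ℝ)) = _ * A.im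
  set ζ : ℝ := mzv (fun _ : Fin n => ((2 * (k + 1) : ℕ) : ℝ))
  have hπ : (π : ℂ) ≠ 0 := by exact_mod_cast Real.pi_ne_zero
  have hI : Complex.I ^ (k + 1) = (-1) ^ q := by
    rw [hq, ← two_mul, pow_mul, Complex.I_sq]
  have hIN : Complex.I ^ N = (-1) ^ q := by
    rw [hN', pow_mul, hI, ← pow_mul, mul_comm, pow_mul, Odd.neg_one_pow ⟨n, rfl⟩]
  have hfac : (N.factorial : ℂ) ≠ 0 := by exact_mod_cast N.factorial_ne_zero
  have h2 : (2 : ℂ) ^ (k + 1) = 4 * 2 ^ (k - 1) := by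
    have : k + 1 = k - 1 + 2 := by omega
    rw [this, pow_add]
    ring
  have hζ : (ζ : ℂ) = (((-1 : ℝ) ^ (n + q) * π ^ (2 * (k + 1) * n) /
      (2 ^ (k - 1) * (N.factorial : ℝ)) : ℝ) : ℂ) * (Complex.I * A) := by
    have hsq (l : ℕ) : (-1 : ℂ) ^ l * (-1) ^ l = 1 := by
      rw [← mul_pow, neg_one_mul, neg_neg, one_pow]
    have hred : Complex.I ^ k * ((-1) ^ n * ζ) =
        π ^ (2 * (k + 1) * n) / (2 ^ (k - 1) * (N.factorial : ℂ)) * A := by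
      apply mul_left_cancel₀ (pow_ne_zero (k + 1) hπ)
      rw [← mul_assoc, hcoeff, mul_pow, mul_pow, hI, hIN, h2, hN, pow_add (π : ℂ), ← hN]
      field_simp
    have hIk : Complex.I ^ k * Complex.I = (-1) ^ q := by rw [← pow_succ, hI]
    push_cast
    calc (ζ : ℂ) = ((-1) ^ n * (-1) ^ n) * ((-1) ^ q * (-1) ^ q) * ζ := by rw [hsq, hsq]; ring
      _ = (-1) ^ (n + q) * Complex.I * (Complex.I ^ k * ((-1) ^ n * ζ)) := by
        nth_rewrite 2 [← hIk]
        ring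
      _ = _ := by
        rw [hred]
        ring
  have hre := congrArg Complex.re hζ
  rw [Complex.re_ofReal_mul, Complex.ofReal_re, Complex.I_mul_re] at hre
  have hhalf : (k + 1) / 2 = q := by omega
  rw [hre, hhalf, pow_add _ (n + 1), pow_add _ n 1, pow_add _ n q]
  have : k + 1 - 2 = k - 1 := by omega
  rw [this]
  ring
end

section
/- Let m ≥ 3 be an odd positive integer and n a positive integer. Then ζ⋆({2m}^n) = (πi)^{2mn} · Σ_{q₁+q₂+⋯+q_m = mn, qⱼ≥0} ( Π_{j=1}^{m} 2^{2qⱼ} B_{2qⱼ}(1/2) / (2qⱼ)! ) · exp( (4πi/m) · Σ_{ℓ=1}^{m} (ℓ−1) q_ℓ ), where B_j(x) denotes the j-th Bernoulli polynomial. -/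
open Real Finset

section Auxiliary

open PowerSeries Filter Topology

section GeometricSeries

variable {K : Type*} [Field K]

/-- The geometric series `1 + a X + a² X² + ⋯`. -/
noncomputable def geomSeries (a : K) : PowerSeries K := PowerSeries.mk fun n => a ^ n

theorem geomSeries_mul_one_sub (a : K) : geomSeries a * (1 - C a * X) = 1 := by
  have h : geomSeries a = rescale a (PowerSeries.mk 1) := by
    ext n; simp [geomSeries, coeff_rescale]
  rw [h, ← rescale_X, ← map_one (rescale a), ← map_sub, ← map_mul, map_one,
    mk_one_mul_one_sub_eq_one, map_one]

theorem rescale_geomSeries (a b : K) : rescale b (geomSeries a) = geomSeries (b * a) := by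
  ext n; simp [geomSeries, coeff_rescale, mul_pow]

theorem X_mul_derivative_geomSeries (a : K) :
    X * d⁄dX K (geomSeries a) = geomSeries a * (geomSeries a - 1) := by
  have h := geomSeries_mul_one_sub a
  have hd := congrArg (d⁄dX K) h
  simp only [Derivation.leibniz, map_sub, smul_eq_mul, derivative_C, derivative_X,
    Derivation.map_one_eq_zero] at hd
  linear_combination (X * geomSeries a) * hd + (-geomSeries a - X * d⁄dX K (geomSeries a)) * h

/-- The generating series of the complete homogeneous symmetric polynomials in
`a 0, …, a (N - 1)`. -/
noncomputable def hsymmSeries (a : ℕ → K) (N : ℕ) : PowerSeries K :=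
  ∏ k ∈ range N, geomSeries (a k)

theorem X_mul_derivative_hsymmSeries (a : ℕ → K) (N : ℕ) :
    X * d⁄dX K (hsymmSeries a N) =
      hsymmSeries a N * ∑ k ∈ range N, (geomSeries (a k) - 1) := by
  induction N with
  | zero => simp [hsymmSeries]
  | succ N ih =>
    have h := X_mul_derivative_geomSeries (a N)
    simp only [hsymmSeries, prod_range_succ, sum_range_succ, Derivation.leibniz,
      smul_eq_mul] at ih ⊢
    linear_combination geomSeries (a N) * ih + (∏ k ∈ range N, geomSeries (a k)) * h

theorem coeff_X_mul_derivative (f : PowerSeries K) (q : ℕ) :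
    coeff q (X * d⁄dX K f) = q * coeff q f := by
  cases q with
  | zero => simp
  | succ q => simp [coeff_succ_X_mul, coeff_derivative, mul_comm]

/-- Newton's identity between complete homogeneous symmetric polynomials and power sums. -/
theorem mul_coeff_hsymmSeries (a : ℕ → K) (N q : ℕ) :
    q * coeff q (hsymmSeries a N) = ∑ p ∈ antidiagonal q,
      coeff p.1 (hsymmSeries a N) * if p.2 = 0 then 0 else ∑ k ∈ range N, a k ^ p.2 := by
  rw [← coeff_X_mul_derivative, X_mul_derivative_hsymmSeries, coeff_mul]
  refine sum_congr rfl fun p _ => ?_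
  simp only [map_sum, map_sub, geomSeries, coeff_mk, coeff_one]
  split_ifs with hp <;> simp [hp]

theorem coeff_zero_hsymmSeries (a : ℕ → K) (N : ℕ) : coeff 0 (hsymmSeries a N) = 1 := by
  simp [hsymmSeries, geomSeries, map_prod]

theorem prod_one_sub_primitiveRoot_pow_mul {m : ℕ} (hm : 0 < m) {ω : K}
    (hω : IsPrimitiveRoot ω m) (a : K) :
    ∏ j : Fin m, (1 - C (ω ^ (j : ℕ) * a) * X) = (1 - C (a ^ m) * X ^ m : PowerSeries K) := by
  have hC : IsPrimitiveRoot (C ω : PowerSeries K) m := hω.map_of_injective C_injective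
  have h := hC.pow_sub_pow_eq_prod_sub_mul 1 (C a * X) hm
  rw [one_pow, mul_pow, ← map_pow] at h
  rw [h]
  refine prod_nbij (fun j => C ω ^ (j : ℕ)) ?_ ?_ ?_ ?_
  · intro j _
    rw [Polynomial.mem_nthRootsFinset hm, ← pow_mul, mul_comm, pow_mul, hC.pow_eq_one, one_pow]
  · intro i _ j _ hij
    exact Fin.ext (hC.pow_inj i.2 j.2 hij)
  · intro x hx
    have : NeZero m := ⟨hm.ne'⟩
    obtain ⟨i, hi, rfl⟩ := hC.eq_pow_of_pow_eq_one
      ((Polynomial.mem_nthRootsFinset hm 1).1 (mem_coe.1 hx))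
    exact ⟨⟨i, hi⟩, by simp, rfl⟩
  · intro j _
    simp [mul_assoc]

theorem prod_rescale_hsymmSeries_succ {m : ℕ} (hm : 0 < m) {ω : K}
    (hω : IsPrimitiveRoot ω m) (a : ℕ → K) (N : ℕ) :
    (∏ j : Fin m, rescale (ω ^ (j : ℕ)) (hsymmSeries a (N + 1))) * (1 - C (a N ^ m) * X ^ m) =
      ∏ j : Fin m, rescale (ω ^ (j : ℕ)) (hsymmSeries a N) := by
  rw [← prod_one_sub_primitiveRoot_pow_mul hm hω, ← prod_mul_distrib]
  refine prod_congr rfl fun j _ => ?_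
  rw [hsymmSeries, prod_range_succ, map_mul, rescale_geomSeries, mul_assoc,
    geomSeries_mul_one_sub, mul_one, hsymmSeries]

end GeometricSeries

theorem coeff_prod_fin {R : Type*} [CommRing R] {m : ℕ} (f : Fin m → PowerSeries R) (d : ℕ) :
    coeff d (∏ j, f j) = ∑ q ∈ Finset.Nat.antidiagonalTuple m d, ∏ j, coeff (q j) (f j) := by
  rw [coeff_prod]
  refine sum_equiv Finsupp.equivFunOnFinite (fun l => ?_) fun _ _ => rfl
  simp [mem_finsuppAntidiag, Finset.Nat.mem_antidiagonalTuple]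

section MonotoneTuples

/-- The monotone `n`-tuples with entries in `{1, …, N}`. -/
def monotoneTuples (n N : ℕ) : Finset (Fin n → ℕ) :=
  {f ∈ Fintype.piFinset fun _ => Icc 1 N | Monotone f}

theorem mem_monotoneTuples {n N : ℕ} {f : Fin n → ℕ} :
    f ∈ monotoneTuples n N ↔ (∀ i, 1 ≤ f i ∧ f i ≤ N) ∧ Monotone f := by
  simp [monotoneTuples, Fintype.mem_piFinset]

theorem monotone_snoc_iff {n : ℕ} {g : Fin n → ℕ} {x : ℕ} :
    Monotone (Fin.snoc g x : Fin (n + 1) → ℕ) ↔ Monotone g ∧ ∀ i, g i ≤ x := by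
  constructor
  · intro h
    refine ⟨fun i j hij => ?_, fun i => ?_⟩
    · simpa using h (Fin.castSucc_le_castSucc_iff.2 hij)
    · simpa using h (Fin.le_last i.castSucc)
  · rintro ⟨hg, hx⟩ i j hij
    induction j using Fin.lastCases with
    | last =>
      induction i using Fin.lastCases with
      | last => rfl
      | cast i => simpa using hx i
    | cast j =>
      induction i using Fin.lastCases with
      | last => exact absurd hij (not_le.2 (Fin.castSucc_lt_last j))
      | cast i => simpa using hg (Fin.castSucc_le_castSucc_iff.1 hij)

theorem sum_monotoneTuples_succ {R : Type*} [CommRing R] (x : ℕ → R) (n N : ℕ) :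
    ∑ f ∈ monotoneTuples (n + 1) (N + 1), ∏ i, x (f i) =
      ∑ f ∈ monotoneTuples (n + 1) N, ∏ i, x (f i) +
        x (N + 1) * ∑ f ∈ monotoneTuples n (N + 1), ∏ i, x (f i) := by
  rw [← sum_filter_add_sum_filter_not _ (fun f => f (Fin.last n) ≤ N)]
  congr 1
  · refine sum_congr ?_ fun _ _ => rfl
    ext f
    simp only [mem_filter, mem_monotoneTuples]
    constructor
    · rintro ⟨⟨h1, h2⟩, h3⟩
      exact ⟨fun i => ⟨(h1 i).1, (h2 (Fin.le_last i)).trans h3⟩, h2⟩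
    · rintro ⟨h1, h2⟩
      exact ⟨⟨fun i => ⟨(h1 i).1, (h1 i).2.trans N.le_succ⟩, h2⟩, (h1 _).2⟩
  · rw [mul_sum]
    refine sum_nbij' Fin.init (fun g => Fin.snoc g (N + 1)) ?_ ?_ ?_ ?_ ?_
    · intro f hf
      simp only [mem_filter, mem_monotoneTuples] at hf ⊢
      exact ⟨fun i => hf.1.1 _, fun i j hij => hf.1.2 (Fin.castSucc_le_castSucc_iff.2 hij)⟩
    · intro g hg
      simp only [mem_filter, mem_monotoneTuples, monotone_snoc_iff] at hg ⊢
      refine ⟨⟨fun i => ?_, hg.2, fun i => (hg.1 i).2⟩, by simp⟩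
      induction i using Fin.lastCases with
      | last => simp
      | cast i => simpa using hg.1 i
    · intro f hf
      simp only [mem_filter, mem_monotoneTuples] at hf
      have : f (Fin.last n) = N + 1 := le_antisymm (hf.1.1 _).2 (by lia)
      rw [← this, Fin.snoc_init_self]
    · intro g _
      simp
    · intro f hf
      simp only [mem_filter, mem_monotoneTuples] at hf
      have : f (Fin.last n) = N + 1 := le_antisymm (hf.1.1 _).2 (by lia)
      rw [Fin.prod_univ_castSucc, this, mul_comm]
      rfl

theorem coeff_prod_rescale_hsymmSeries {K : Type*} [Field K] {m : ℕ} (hm : 0 < m) {ω : K}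
    (hω : IsPrimitiveRoot ω m) (x : ℕ → K) (n N : ℕ) :
    coeff (m * n) (∏ j : Fin m, rescale (ω ^ (j : ℕ)) (hsymmSeries (fun k => x (k + 1)) N)) =
      ∑ f ∈ monotoneTuples n N, ∏ i, x (f i) ^ m := by
  induction n generalizing N with
  | zero =>
    have h : monotoneTuples 0 N = {Fin.elim0} := by
      ext f
      simp [mem_monotoneTuples, Subsingleton.monotone, Subsingleton.elim f Fin.elim0]
    have h0 := coeff_zero_hsymmSeries (fun k => x (k + 1)) N
    simp only [coeff_zero_eq_constantCoeff] at h0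
    simp [h, map_prod, ← coeff_zero_eq_constantCoeff_apply, coeff_rescale, h0]
  | succ n ihn =>
    induction N with
    | zero =>
      have h : monotoneTuples (n + 1) 0 = ∅ := by
        ext f
        simp only [mem_monotoneTuples, notMem_empty, iff_false]
        intro h
        have := h.1 0
        lia
      simp [h, hsymmSeries, coeff_one, hm.ne']
    | succ N ihN =>
      have h := congrArg (coeff (m * (n + 1)))
        (prod_rescale_hsymmSeries_succ hm hω (fun k => x (k + 1)) N)
      rw [mul_sub, mul_one, map_sub, ihN, mul_add_one, mul_left_comm, coeff_C_mul,
        coeff_mul_X_pow, ihn (N + 1), sub_eq_iff_eq_add] at h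
      rw [mul_add_one, h, sum_monotoneTuples_succ (fun k => x k ^ m)]

end MonotoneTuples

theorem half_bernoulli_recursion (q : ℕ) :
    2 * (q : ℚ) * ((Polynomial.bernoulli (2 * q)).eval (1 / 2) / (2 * q).factorial) =
      - ∑ p ∈ antidiagonal q,
        (Polynomial.bernoulli (2 * p.1)).eval (1 / 2) / (2 * p.1).factorial *
          if p.2 = 0 then 0 else bernoulli (2 * p.2) / (2 * p.2).factorial := by
  set F : PowerSeries ℚ := PowerSeries.mk fun n =>
    Polynomial.aeval (1 / 2 : ℚ) ((1 / n.factorial : ℚ) • Polynomial.bernoulli n) with hF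
  have hFc (n : ℕ) : coeff n F = (Polynomial.bernoulli n).eval (1 / 2) / n.factorial := by
    simp [hF, Polynomial.aeval_def, Polynomial.eval₂_eq_eval_map, div_eq_inv_mul]
  set B := bernoulliPowerSeries ℚ with hB
  have hBc (n : ℕ) : coeff n B = bernoulli n / n.factorial := by
    simp [hB, bernoulliPowerSeries]
  set e := PowerSeries.exp ℚ with he
  have h1 : F * (e - 1) = X * rescale (1 / 2) e := Polynomial.bernoulli_generating_function _
  have h2 : B * (e - 1) = X := bernoulliPowerSeries_mul_exp_sub_one ℚ
  have hde : d⁄dX ℚ e = e := by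
    ext n
    simp [he, coeff_derivative, coeff_exp, Nat.factorial_succ]
    field_simp
  have hdr : d⁄dX ℚ (rescale (1 / 2) e) = C (1 / 2) * rescale (1 / 2) e := by
    ext n
    simp only [he, coeff_derivative, coeff_exp, Nat.factorial_succ, coeff_rescale, coeff_C_mul]
    simp
    field_simp
    ring
  have he1 : e - 1 ≠ 0 := by
    intro h
    rw [h, mul_zero] at h2
    exact X_ne_zero h2.symm
  have hd := congrArg (d⁄dX ℚ) h1
  simp only [Derivation.leibniz, map_sub, smul_eq_mul, derivative_X,
    Derivation.map_one_eq_zero, hde, hdr] at hd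
  have key : X * d⁄dX ℚ F = F * (1 - C (1 / 2) * X - B) := by
    apply mul_right_cancel₀ he1
    have hC : (C (1 / 2) : PowerSeries ℚ) * 2 = 1 := by
      rw [← map_ofNat C 2, ← map_mul]; norm_num
    linear_combination X * hd - (1 + C (1 / 2) * X) * h1 + F * h2 + F * X * (e - 1) * hC
  have hc := congrArg (coeff (2 * q)) key
  rw [coeff_X_mul_derivative, coeff_mul, hFc] at hc
  push_cast at hc
  rw [hc, ← sum_neg_distrib]
  symm
  refine sum_of_injOn (fun p => (2 * p.1, 2 * p.2)) ?_ ?_ ?_ ?_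
  · intro p _ r _ h
    simp only [Prod.mk.injEq] at h
    ext <;> lia
  · intro p hp
    simp only [mem_coe, HasAntidiagonal.mem_antidiagonal] at hp ⊢
    lia
  · rintro ⟨i, j⟩ hp hn
    rw [HasAntidiagonal.mem_antidiagonal] at hp
    have hj : Odd j := by
      rw [← Nat.not_even_iff_odd, even_iff_exists_two_mul]
      rintro ⟨b, rfl⟩
      refine hn ⟨(q - b, b), ?_, ?_⟩
      · simp only [mem_coe, HasAntidiagonal.mem_antidiagonal]
        lia
      · simp only [Prod.mk.injEq, and_true]
        lia
    rcases eq_or_ne j 1 with rfl | hj1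
    · simp [hBc, coeff_one, bernoulli_one]
      norm_num
    · have hj0 : j ≠ 0 := hj.pos.ne'
      simp [hBc, coeff_one, coeff_X, hj1, hj0, bernoulli_eq_zero_of_odd hj (by lia)]
  · rintro ⟨i, j⟩ _
    rcases eq_or_ne j 0 with rfl | hj
    · have h0 : constantCoeff B = 1 := by
        rw [← coeff_zero_eq_constantCoeff_apply, hBc]
        simp
      simp [h0]
    · have h1 : 2 * j ≠ 1 := by lia
      simp [hBc, hFc, coeff_one, coeff_X, hj, h1]

theorem tendsto_coeff_hsymmSeries {a Z L : ℕ → ℂ}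
    (hZ : ∀ j ≠ 0, Tendsto (fun N => ∑ k ∈ range N, a k ^ j) atTop (𝓝 (Z j))) (hL₀ : L 0 = 1)
    (hL : ∀ q : ℕ, q * L q = ∑ p ∈ antidiagonal q, L p.1 * if p.2 = 0 then 0 else Z p.2)
    (q : ℕ) : Tendsto (fun N => coeff q (hsymmSeries a N)) atTop (𝓝 (L q)) := by
  induction q using Nat.strong_induction_on with
  | _ q ih =>
    rcases eq_or_ne q 0 with rfl | hq
    · simp only [coeff_zero_hsymmSeries, hL₀, tendsto_const_nhds]
    · have hq' : (q : ℂ) ≠ 0 := Nat.cast_ne_zero.2 hq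
      have h : Tendsto (fun N => (q : ℂ) * coeff q (hsymmSeries a N)) atTop
          (𝓝 (q * L q)) := by
        simp_rw [mul_coeff_hsymmSeries, hL]
        refine tendsto_finsetSum _ fun p hp => ?_
        rw [HasAntidiagonal.mem_antidiagonal] at hp
        by_cases hp2 : p.2 = 0
        · simp [hp2]
        · simp only [hp2, if_false]
          exact (ih p.1 (by lia)).mul (hZ p.2 hp2)
      simpa [hq'] using h.const_mul (q : ℂ)⁻¹

theorem tendsto_coeff_hsymmSeries_inv_sq (q : ℕ) :
    Tendsto (fun N => coeff q (hsymmSeries (fun k => 1 / ((k + 1 : ℕ) : ℂ) ^ 2) N)) atTop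
      (𝓝 ((π * Complex.I) ^ (2 * q) * (2 ^ (2 * q) *
        (((Polynomial.bernoulli (2 * q)).eval ((1 : ℚ) / 2) : ℚ) : ℂ) /
          (Nat.factorial (2 * q))))) := by
  refine tendsto_coeff_hsymmSeries
    (Z := fun j => -((π * Complex.I) ^ (2 * j) * 2 ^ (2 * j) *
      (bernoulli (2 * j) / (2 * j).factorial : ℚ) / 2))
    (L := fun q => (π * Complex.I) ^ (2 * q) * (2 ^ (2 * q) *
        (((Polynomial.bernoulli (2 * q)).eval ((1 : ℚ) / 2) : ℚ) : ℂ) /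
          (Nat.factorial (2 * q)))) ?_ ?_ ?_ q
  · intro j hj
    have h := (hasSum_nat_add_iff' 1).2 (hasSum_zeta_nat hj)
    have h' := (Complex.continuous_ofReal.tendsto _).comp h.tendsto_sum_nat
    convert h' using 1
    · ext N
      simp [pow_mul]
    · congr 1
      obtain ⟨i, rfl⟩ := Nat.exists_eq_succ_of_ne_zero hj
      simp only [mul_pow, pow_mul, Complex.I_sq]
      have : 2 * i.succ - 1 = 2 * i + 1 := by lia
      rw [this]
      simp [pow_mul, pow_succ]
      ring
  · simp
  · intro q
    have h := congrArg (fun r : ℚ => (π * Complex.I) ^ (2 * q) * 2 ^ (2 * q) * (r : ℂ) / 2)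
      (half_bernoulli_recursion q)
    push_cast at h
    rw [mul_neg, neg_div, mul_sum, sum_div, ← sum_neg_distrib] at h
    refine Eq.trans (by ring) (h.trans (sum_congr rfl fun p hp => ?_))
    rw [HasAntidiagonal.mem_antidiagonal] at hp
    split_ifs with h0
    · simp
    · rw [← hp]
      push_cast
      ring

theorem hasSum_of_tendsto_sum_monotoneTuples {n : ℕ} {g : (Fin n → ℕ) → ℝ} {r : ℝ}
    (hg : ∀ f, 0 ≤ g f)
    (h : Tendsto (fun N => ∑ f ∈ monotoneTuples n N, g f) atTop (𝓝 r)) :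
    HasSum (fun f : {f : Fin n → ℕ // (∀ i, 1 ≤ f i) ∧ Monotone f} => g f.1) r := by
  classical
  set T : ℕ → Finset {f : Fin n → ℕ // (∀ i, 1 ≤ f i) ∧ Monotone f} :=
    fun N => (monotoneTuples n N).subtype _ with hT
  have hmem (N : ℕ) (f) : f ∈ T N ↔ ∀ i, f.1 i ≤ N := by
    simp only [hT, mem_subtype, mem_monotoneTuples]
    exact ⟨fun hf i => (hf.1 i).2, fun hf => ⟨fun i => ⟨f.2.1 i, hf i⟩, f.2.2⟩⟩
  have hmono : Monotone T := fun N M hNM f hf =>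
    (hmem M f).2 fun i => ((hmem N f).1 hf i).trans hNM
  have htop : Tendsto T atTop atTop := tendsto_atTop_finset_of_monotone hmono fun f =>
    ⟨∑ i, f.1 i, (hmem _ f).2 fun i => single_le_sum (fun _ _ => Nat.zero_le _) (mem_univ i)⟩
  have hsum (N : ℕ) : ∑ f ∈ T N, g f.1 = ∑ f ∈ monotoneTuples n N, g f :=
    sum_subtype_of_mem g fun f hf => by
      rw [mem_monotoneTuples] at hf
      exact ⟨fun i => (hf.1 i).1, hf.2⟩
  simp_rw [← hsum] at h
  have hle (N : ℕ) : ∑ f ∈ T N, g f.1 ≤ r :=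
    Monotone.ge_of_tendsto (f := fun N => ∑ f ∈ T N, g f.1)
      (fun _ _ hNM => sum_le_sum_of_subset_of_nonneg (hmono hNM) fun f _ _ => hg f.1) h N
  have hs : Summable fun f : {f : Fin n → ℕ // (∀ i, 1 ≤ f i) ∧ Monotone f} => g f.1 := by
    refine summable_of_sum_le (c := r) (fun f => hg f.1) fun u => ?_
    obtain ⟨N, hN⟩ := (htop.eventually_ge_atTop u).exists
    exact (sum_le_sum_of_subset_of_nonneg hN fun f _ _ => hg f.1).trans (hle N)
  rw [tendsto_nhds_unique h (hs.hasSum.comp htop)]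
  exact hs.hasSum

theorem tendsto_sum_monotoneTuples {m : ℕ} (hm : 0 < m) (hmo : Odd m) (n : ℕ) :
    Tendsto (fun N => ∑ f ∈ monotoneTuples n N, ∏ i, (1 / (f i : ℂ) ^ 2) ^ m) atTop
      (𝓝 ((π * Complex.I) ^ (2 * m * n) *
        ∑ q ∈ Finset.Nat.antidiagonalTuple m (m * n),
          (∏ j : Fin m,
            2 ^ (2 * q j) *
              (((Polynomial.bernoulli (2 * q j)).eval ((1 : ℚ) / 2) : ℚ) : ℂ) /
                (Nat.factorial (2 * q j))) *
          Complex.exp (4 * π * Complex.I / m * ((∑ j : Fin m, (j : ℕ) * q j : ℕ) : ℂ)))) := by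
  have hω := Complex.isPrimitiveRoot_exp_of_coprime 2 m hm.ne' (Nat.coprime_two_left.2 hmo)
  simp_rw [← coeff_prod_rescale_hsymmSeries hm hω (fun k => 1 / (k : ℂ) ^ 2),
    coeff_prod_fin, mul_sum]
  refine tendsto_finsetSum _ fun q hq => ?_
  rw [Finset.Nat.mem_antidiagonalTuple] at hq
  simp_rw [coeff_rescale]
  have h := tendsto_finsetProd univ fun (j : Fin m) _ =>
    (tendsto_coeff_hsymmSeries_inv_sq (q j)).const_mul
      ((Complex.exp (2 * π * Complex.I * ((2 : ℕ) / m)) ^ (j : ℕ)) ^ q j)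
  convert h using 2
  rw [prod_mul_distrib, prod_mul_distrib, prod_pow_eq_pow_sum, ← mul_sum, hq]
  simp_rw [← pow_mul, prod_pow_eq_pow_sum, ← Complex.exp_nat_mul]
  rw [show Complex.exp (4 * π * Complex.I / m * ((∑ j : Fin m, (j : ℕ) * q j : ℕ) : ℂ)) =
    Complex.exp (((∑ j : Fin m, (j : ℕ) * q j : ℕ) : ℂ) *
      (2 * π * Complex.I * ((2 : ℕ) / m))) by congr 1; push_cast; ring, mul_assoc 2 m n]
  ring

end Auxiliary

/-- For odd `m ≥ 3`,
`ζ⋆({2m}^n) = (πi)^{2mn} Σ_{q₁+⋯+q_m = mn} (Π_j 2^{2q_j} B_{2q_j}(1/2)/(2q_j)!) ·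
  exp((4πi/m) Σ_ℓ (ℓ-1) q_ℓ)`. -/
theorem zeta_star_two_m_rep_odd' (m n : ℕ) (hm : 3 ≤ m) (hmo : Odd m) (hn : 1 ≤ n) :
    (mzsv (fun _ : Fin n => ((2 * m : ℕ) : ℝ)) : ℂ) =
      (π * Complex.I) ^ (2 * m * n) *
        ∑ q ∈ Finset.Nat.antidiagonalTuple m (m * n),
          (∏ j : Fin m,
            2 ^ (2 * q j) *
              (((Polynomial.bernoulli (2 * q j)).eval ((1 : ℚ) / 2) : ℚ) : ℂ) /
                (Nat.factorial (2 * q j))) *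
          Complex.exp (4 * π * Complex.I / m * ((∑ j : Fin m, (j : ℕ) * q j : ℕ) : ℂ)) := by
  have hm0 : 0 < m := by lia
  have h := tendsto_sum_monotoneTuples hm0 hmo n
  set R := (π * Complex.I) ^ (2 * m * n) * _
  have hcast : (fun N => ∑ f ∈ monotoneTuples n N, ∏ i, (1 / (f i : ℂ) ^ 2) ^ m) =
      fun N => ((∑ f ∈ monotoneTuples n N, ∏ i, (f i : ℝ) ^ (-((2 * m : ℕ) : ℝ)) : ℝ) : ℂ) := by
    ext N
    simp_rw [Real.rpow_neg (Nat.cast_nonneg _), Real.rpow_natCast]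
    push_cast
    simp [pow_mul]
  rw [hcast] at h
  have hre := (Complex.continuous_re.tendsto R).comp h
  have hs := hasSum_of_tendsto_sum_monotoneTuples
    (g := fun f : Fin n → ℕ => ∏ i, (f i : ℝ) ^ (-((2 * m : ℕ) : ℝ)))
    (fun f => prod_nonneg fun i _ => by positivity) hre
  rw [mzsv, hs.tsum_eq]
  exact tendsto_nhds_unique ((Complex.continuous_ofReal.tendsto _).comp hre) h
end
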